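/- Let τ denote the translation of F^n by the word (1,1,1,1,0,…,0) (ones in the first four coordinates). Then Aut({r + Ω(A^{m−2})}_{r∈V^{m−1}}) = Aut(Ω(A^{m−2})) ∪ {g∘τ : g ∈ Aut(Ω(A^{m−2}))}; i.e., an isometry of F^n preserves the collection {r + Ω(A^{m−2})}_{r∈V^{m−1}} if and only if it lies in Aut(Ω(A^{m−2})) or is the composition of an element of Aut(Ω(A^{m−2})) with τ. -/

import Mathlib

open Finset Pointwise

abbrev Word (n : ℕ) := Fin n → ZMod 2

def FEv (n : ℕ) : Set (Word n) := {x | Even (hammingNorm x)}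

def FOd (n : ℕ) : Set (Word n) := {x | ¬ Even (hammingNorm x)}

def nbr {n : ℕ} (S : Set (Word n)) : Set (Word n) := {y | ∃ x ∈ S, hammingDist y x = 1}

def theta {n : ℕ} (G : Set (Word n)) : Set (Word n) :=
  {x | Even (hammingNorm x) ∧ nbr {x} ⊆ nbr G}

def ExtPerfect {n : ℕ} (C : Set (Word n)) : Prop :=
  C ⊆ FEv n ∧ (∀ x ∈ C, ∀ y ∈ C, x ≠ y → Disjoint (nbr {x}) (nbr {y})) ∧ nbr C = FOd n

def IsIsometry {n : ℕ} (g : Word n → Word n) : Prop :=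
  Function.Bijective g ∧ ∀ x y, hammingDist (g x) (g y) = hammingDist x y

def embWord (m t : ℕ) (v : Word (2 ^ (m - t))) : Word (2 ^ m) := fun i =>
  if h : (i : ℕ) < 2 ^ (m - t) then v ⟨i, h⟩
  else if h2 : (i : ℕ) < 2 * 2 ^ (m - t) then v ⟨(i : ℕ) - 2 ^ (m - t), by omega⟩
  else 0

def Vt (m t : ℕ) : Set (Word (2 ^ m)) :=
  {x | ∃ v : Word (2 ^ (m - t)), Even (hammingNorm v) ∧ x = embWord m t v}

def At (m : ℕ) : ℕ → Set (Word (2 ^ m))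
  | 0 => {0}
  | 1 => Vt m 1
  | t + 2 => Vt m (t + 2) + At m (t + 1)

def IsComp (m t : ℕ) (G : Set (Word (2 ^ m))) : Prop :=
  G ⊆ FEv (2 ^ m) ∧ G.ncard = (At m t).ncard ∧ nbr G = nbr (At m t)

def IsMuComp (m t : ℕ) (μ : Word (2 ^ m)) (M : Set (Word (2 ^ m))) : Prop :=
  (∀ i : Fin (2 ^ m), 2 ^ (m - t) ≤ (i : ℕ) → μ i = 0) ∧
  ∃ G, IsComp m t G ∧ M = (fun x => μ + x) '' G

def arrEntry (m t : ℕ) (x : Word (2 ^ m)) (i : Fin (2 ^ t)) (j : Fin (2 ^ (m - t))) : ZMod 2 :=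
  x ⟨((i : ℕ) * 2 ^ (m - t) + (j : ℕ)) % 2 ^ m, Nat.mod_lt _ (Nat.two_pow_pos m)⟩

def pchk (m t : ℕ) (x : Word (2 ^ m)) : Word (2 ^ (m - t)) :=
  fun j => ∑ i : Fin (2 ^ t), arrEntry m t x i j

def Bt (m : ℕ) : ℕ → Set (Word (2 ^ m))
  | 0 => Vt m 1
  | 1 => Vt m 1
  | t + 2 => Vt m (t + 2) + theta (At m (t + 1))

/-- The linear functional on words with coefficient sequence `c`. -/
def pairing {n : ℕ} (c : ℕ → ZMod 2) (x : Word n) : ZMod 2 := ∑ i : Fin n, c i * x i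

/-- The `k`-th binary digit, as a coefficient sequence. -/
def bitCoeff (k i : ℕ) : ZMod 2 := if i.testBit k then 1 else 0

/-- The coefficient sequence supported on the indices congruent to 3 modulo 4. -/
def cornerCoeff (i : ℕ) : ZMod 2 := if i % 4 = 3 then 1 else 0

/-- The word `(1,1,1,1,0,…,0)`. -/
def fourOnes (n : ℕ) : Word n := fun i => if (i : ℕ) < 4 then 1 else 0

theorem pairing_add {n : ℕ} (c : ℕ → ZMod 2) (x y : Word n) :
    pairing c (x + y) = pairing c x + pairing c y := by
  simp [pairing, mul_add, Finset.sum_add_distrib]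

theorem pairing_single {n : ℕ} (c : ℕ → ZMod 2) (i : Fin n) :
    pairing c (Pi.single i 1) = c i := by
  simp [pairing, Pi.single_apply]

theorem pairing_zero {n : ℕ} (c : ℕ → ZMod 2) : pairing c (0 : Word n) = 0 := by
  simp [pairing]

theorem natCast_hammingNorm {n : ℕ} (x : Word n) :
    (hammingNorm x : ZMod 2) = pairing 1 x := by
  have h : ∀ a : ZMod 2, (if a ≠ 0 then 1 else 0 : ZMod 2) = a := by decide
  simp only [hammingNorm, Finset.natCast_card_filter, pairing, h, Pi.one_apply, one_mul]

theorem even_hammingNorm_iff {n : ℕ} (x : Word n) :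
    Even (hammingNorm x) ↔ pairing 1 x = 0 := by
  rw [← natCast_hammingNorm, ZMod.natCast_eq_zero_iff_even]

theorem word_add_self {n : ℕ} (x : Word n) : x + x = 0 := by
  ext i; exact CharTwo.add_self_eq_zero _

theorem word_add_cancel_left {n : ℕ} (x y : Word n) : x + (x + y) = y := by
  rw [← add_assoc, word_add_self, zero_add]

theorem word_neg {n : ℕ} (x : Word n) : -x = x :=
  neg_eq_of_add_eq_zero_left (word_add_self x)

theorem hammingDist_eq_norm_add {n : ℕ} (x y : Word n) :
    hammingDist x y = hammingNorm (x + y) := by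
  rw [hammingDist_eq_hammingNorm, word_neg]

theorem natCast_hammingDist {n : ℕ} (x y : Word n) :
    (hammingDist x y : ZMod 2) = pairing 1 x + pairing 1 y := by
  rw [hammingDist_eq_norm_add, natCast_hammingNorm, pairing_add]

theorem hammingNorm_eq_one_iff {n : ℕ} (x : Word n) :
    hammingNorm x = 1 ↔ ∃ i, x = Pi.single i 1 := by
  rw [hammingNorm, Finset.card_eq_one]
  refine exists_congr fun i => ?_
  simp only [Finset.ext_iff, Finset.mem_filter, Finset.mem_univ, true_and, Finset.mem_singleton,
    funext_iff, Pi.single_apply]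
  refine forall_congr' fun j => ?_
  generalize x j = a
  by_cases h : j = i <;> simp only [h, iff_true, iff_false, if_true, if_false] <;>
    revert a <;> decide

theorem mem_nbr_iff {n : ℕ} (S : Set (Word n)) (y : Word n) :
    y ∈ nbr S ↔ ∃ i, y + Pi.single i 1 ∈ S := by
  constructor
  · rintro ⟨x, hx, hd⟩
    rw [hammingDist_eq_norm_add, hammingNorm_eq_one_iff] at hd
    obtain ⟨i, hi⟩ := hd
    exact ⟨i, by rwa [← hi, word_add_cancel_left]⟩
  · rintro ⟨i, hi⟩
    refine ⟨_, hi, ?_⟩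
    rw [hammingDist_eq_norm_add, word_add_cancel_left, hammingNorm_eq_one_iff]
    exact ⟨i, rfl⟩

theorem pairing_embWord {m t : ℕ} (ht : 1 ≤ t) (htm : t ≤ m) (c : ℕ → ZMod 2) (k : ZMod 2)
    (hc : ∀ j < 2 ^ (m - t), c j + c (j + 2 ^ (m - t)) = k) (v : Word (2 ^ (m - t))) :
    pairing c (embWord m t v) = k * pairing 1 v := by
  have hle : 2 ^ (m - t) + 2 ^ (m - t) ≤ 2 ^ m := by
    calc 2 ^ (m - t) + 2 ^ (m - t) = 2 ^ (m - t + 1) := by ring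
      _ ≤ 2 ^ m := Nat.pow_le_pow_right (by norm_num) (by omega)
  let w : ℕ → ZMod 2 := fun i =>
    if h : i < 2 ^ (m - t) then v ⟨i, h⟩
    else if h2 : i < 2 * 2 ^ (m - t) then v ⟨i - 2 ^ (m - t), by omega⟩
    else 0
  calc pairing c (embWord m t v) = ∑ i : Fin (2 ^ m), (fun i => c i * w i) i := rfl
    _ = ∑ i ∈ range (2 ^ m), c i * w i :=
      Fin.sum_univ_eq_sum_range (fun i => c i * w i) _
    _ = ∑ i ∈ range (2 ^ (m - t) + 2 ^ (m - t)), c i * w i := by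
      refine (Finset.sum_subset (Finset.range_subset_range.2 hle) fun i _ hi => ?_).symm
      rw [Finset.mem_range] at hi
      simp only [w]
      rw [dif_neg (by omega), dif_neg (by omega), mul_zero]
    _ = ∑ i ∈ range (2 ^ (m - t)), k * w i := by
      rw [Finset.sum_range_add, ← Finset.sum_add_distrib]
      refine Finset.sum_congr rfl fun i hi => ?_
      rw [Finset.mem_range] at hi
      have hw : w (2 ^ (m - t) + i) = w i := by
        simp only [w]
        rw [dif_neg (by omega), dif_pos (by omega), dif_pos hi]
        congr 2
        omega
      rw [hw, ← add_mul, ← hc i hi, add_comm i]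
    _ = ∑ i : Fin (2 ^ (m - t)), k * w i :=
      (Fin.sum_univ_eq_sum_range (fun i => k * w i) _).symm
    _ = k * pairing 1 v := by
      rw [pairing, Finset.mul_sum]
      refine Finset.sum_congr rfl fun i _ => ?_
      simp [w]

theorem pairing_eq_zero_of_mem_At {m : ℕ} (c : ℕ → ZMod 2) (t : ℕ) (htm : t ≤ m)
    (hc : ∀ s, m - t ≤ s → ∃ k, ∀ j < 2 ^ s, c j + c (j + 2 ^ s) = k)
    (x : Word (2 ^ m)) (hx : x ∈ At m t) : pairing c x = 0 := by
  have hV : ∀ s, 1 ≤ s → s ≤ t → ∀ y ∈ Vt m s, pairing c y = 0 := by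
    rintro s hs hst y ⟨v, hv, rfl⟩
    obtain ⟨k, hk⟩ := hc (m - s) (by omega)
    rw [pairing_embWord hs (by omega) c k hk, (even_hammingNorm_iff v).1 hv, mul_zero]
  induction t using At.induct generalizing x with
  | case1 =>
    obtain rfl : x = 0 := hx
    exact pairing_zero c
  | case2 => exact hV 1 le_rfl le_rfl x hx
  | case3 t ih =>
    obtain ⟨a, ha, b, hb, rfl⟩ := hx
    rw [pairing_add, hV _ (by omega) le_rfl a ha, zero_add]
    exact ih (by omega) (fun s hs => hc s (by omega)) b hb
      fun s hs hst => hV s hs (by omega)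

theorem one_add_shift (s : ℕ) :
    ∃ k, ∀ j < 2 ^ s, (1 : ℕ → ZMod 2) j + (1 : ℕ → ZMod 2) (j + 2 ^ s) = k :=
  ⟨_, fun _ _ => rfl⟩

theorem bitCoeff_add_shift (r s : ℕ) :
    ∃ k, ∀ j < 2 ^ s, bitCoeff r j + bitCoeff r (j + 2 ^ s) = k := by
  refine ⟨if r = s then 1 else 0, fun j hj => ?_⟩
  rw [add_comm j]
  simp only [bitCoeff]
  rcases lt_trichotomy r s with h | rfl | h
  · rw [Nat.testBit_two_pow_add_gt h, if_neg h.ne]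
    exact CharTwo.add_self_eq_zero _
  · rw [Nat.testBit_two_pow_add_eq, Nat.testBit_lt_two_pow hj]
    simp
  · have hsr : 2 ^ (s + 1) ≤ 2 ^ r := Nat.pow_le_pow_right (by norm_num) h
    rw [pow_succ] at hsr
    rw [Nat.testBit_lt_two_pow (by omega : j < 2 ^ r),
      Nat.testBit_lt_two_pow (by omega : 2 ^ s + j < 2 ^ r), if_neg h.ne']
    simp

theorem cornerCoeff_add_shift (s : ℕ) (hs : 2 ≤ s) :
    ∃ k, ∀ j < 2 ^ s, cornerCoeff j + cornerCoeff (j + 2 ^ s) = k := by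
  refine ⟨0, fun j _ => ?_⟩
  obtain ⟨r, rfl⟩ := Nat.exists_eq_add_of_le hs
  have h : (j + 2 ^ (2 + r)) % 4 = j % 4 := by rw [pow_add]; omega
  simp only [cornerCoeff, h]
  exact CharTwo.add_self_eq_zero _

theorem exists_mem_Vt_add_supported {m t : ℕ} (ht : 1 ≤ t) (htm : t ≤ m) (x : Word (2 ^ m))
    (hx : ∀ i : Fin (2 ^ m), 2 * 2 ^ (m - t) ≤ (i : ℕ) → x i = 0)
    (hb : pairing (bitCoeff (m - t)) x = 0) :
    ∃ a ∈ Vt m t, ∀ i : Fin (2 ^ m), 2 ^ (m - t) ≤ (i : ℕ) → (a + x) i = 0 := by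
  have hle : 2 ^ (m - t) + 2 ^ (m - t) ≤ 2 ^ m := by
    calc 2 ^ (m - t) + 2 ^ (m - t) = 2 ^ (m - t + 1) := by ring
      _ ≤ 2 ^ m := Nat.pow_le_pow_right (by norm_num) (by omega)
  let e : Fin (2 ^ (m - t)) → Fin (2 ^ m) := fun j => ⟨j + 2 ^ (m - t), by omega⟩
  refine ⟨embWord m t (fun j => x (e j)), ⟨_, ?_, rfl⟩, ?_⟩
  · rw [even_hammingNorm_iff, ← hb]
    refine Fintype.sum_of_injective e (fun a b h => ?_) _ _ (fun i hi => ?_) fun j => ?_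
    · simp only [e, Fin.mk.injEq] at h
      exact Fin.ext (by omega)
    · by_cases h : (i : ℕ) < 2 ^ (m - t)
      · simp [bitCoeff, Nat.testBit_lt_two_pow h]
      · rw [hx i, mul_zero]
        by_contra h2
        exact hi ⟨⟨i - 2 ^ (m - t), by omega⟩, Fin.ext (by simp only [e]; omega)⟩
    · have hbit : bitCoeff (m - t) (e j) = 1 := by
        have h : ((j : ℕ) + 2 ^ (m - t)).testBit (m - t) = true := by
          rw [add_comm, Nat.testBit_two_pow_add_eq, Nat.testBit_lt_two_pow j.2, Bool.not_false]
        exact if_pos h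
      rw [hbit, Pi.one_apply]
  · intro i hi
    by_cases h : (i : ℕ) < 2 * 2 ^ (m - t)
    · have hei : e ⟨i - 2 ^ (m - t), by omega⟩ = i := Fin.ext (by simp only [e]; omega)
      simp only [Pi.add_apply, embWord]
      rw [dif_neg (by omega), dif_pos h, hei]
      exact CharTwo.add_self_eq_zero _
    · simp only [Pi.add_apply, embWord]
      rw [dif_neg (by omega), dif_neg h, hx i (by omega), add_zero]

theorem exists_mem_At_add_supported {m : ℕ} (x : Word (2 ^ m))
    (hb : ∀ k, pairing (bitCoeff k) x = 0) (t : ℕ) (htm : t ≤ m) :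
    ∃ a ∈ At m t, ∀ i : Fin (2 ^ m), 2 ^ (m - t) ≤ (i : ℕ) → (a + x) i = 0 := by
  induction t using At.induct with
  | case1 => exact ⟨0, rfl, fun i hi => absurd i.2 (not_lt.2 hi)⟩
  | case2 =>
    refine exists_mem_Vt_add_supported le_rfl htm x (fun i hi => absurd i.2 ?_) (hb _)
    obtain ⟨m, rfl⟩ := Nat.exists_eq_add_of_le' htm
    simp only [Nat.add_sub_cancel, pow_succ] at hi ⊢
    omega
  | case3 t ih =>
    obtain ⟨a, ha, hax⟩ := ih (by omega)
    have hpow : 2 ^ (m - (t + 1)) = 2 * 2 ^ (m - (t + 2)) := by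
      rw [show m - (t + 1) = m - (t + 2) + 1 by omega, pow_succ']
    obtain ⟨b, hbV, hbx⟩ := exists_mem_Vt_add_supported (t := t + 2) (by omega) htm (a + x)
      (fun i hi => hax i (by omega)) (by
        rw [pairing_add, hb, add_zero]
        exact pairing_eq_zero_of_mem_At _ _ (by omega)
          (fun s _ => bitCoeff_add_shift _ s) a ha)
    exact ⟨b + a, ⟨b, hbV, a, ha, rfl⟩, by rwa [add_assoc]⟩

theorem pairing_of_supported_four {n : ℕ} (hn : 4 ≤ n) (c : ℕ → ZMod 2) (x : Word n)
    (hx : ∀ i : Fin n, 4 ≤ (i : ℕ) → x i = 0) :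
    pairing c x = ∑ i : Fin 4, c i * x (Fin.castLE hn i) := by
  refine (Fintype.sum_of_injective (Fin.castLE hn) (Fin.castLE_injective hn) _ _
    (fun i hi => ?_) fun _ => rfl).symm
  rw [hx i, mul_zero]
  by_contra h
  exact hi ⟨⟨i, by omega⟩, rfl⟩

theorem eq_zero_of_four_checks : ∀ w : Fin 4 → ZMod 2,
    ∑ i : Fin 4, (1 : ℕ → ZMod 2) i * w i = 0 →
    ∑ i : Fin 4, bitCoeff 0 i * w i = 0 → ∑ i : Fin 4, bitCoeff 1 i * w i = 0 →
    ∑ i : Fin 4, cornerCoeff i * w i = 0 → w = 0 := by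
  decide

theorem mem_At_sub_two_iff {m : ℕ} (hm : 2 ≤ m) (x : Word (2 ^ m)) :
    x ∈ At m (m - 2) ↔
      pairing 1 x = 0 ∧ (∀ k, pairing (bitCoeff k) x = 0) ∧ pairing cornerCoeff x = 0 := by
  have hmem : ∀ y ∈ At m (m - 2),
      pairing 1 y = 0 ∧ (∀ k, pairing (bitCoeff k) y = 0) ∧ pairing cornerCoeff y = 0 :=
    fun y hy => ⟨pairing_eq_zero_of_mem_At _ _ (by omega) (fun s _ => one_add_shift s) y hy,
      fun k => pairing_eq_zero_of_mem_At _ _ (by omega) (fun s _ => bitCoeff_add_shift k s) y hy,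
      pairing_eq_zero_of_mem_At _ _ (by omega)
        (fun s hs => cornerCoeff_add_shift s (by omega)) y hy⟩
  refine ⟨hmem x, fun ⟨h1, hb, hc⟩ => ?_⟩
  obtain ⟨a, ha, hax⟩ := exists_mem_At_add_supported x hb (m - 2) (by omega)
  obtain ⟨a1, ab, ac⟩ := hmem a ha
  have hn : 4 ≤ 2 ^ m := Nat.pow_le_pow_right (n := 2) (by norm_num) hm
  have hsup : ∀ i : Fin (2 ^ m), 4 ≤ (i : ℕ) → (a + x) i = 0 := fun i hi =>
    hax i (by rwa [show m - (m - 2) = 2 by omega])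
  have hzero : ∀ c, pairing c a = 0 → pairing c x = 0 →
      ∑ i : Fin 4, c i * (a + x) (Fin.castLE hn i) = 0 := fun c h h' => by
    rw [← pairing_of_supported_four hn c _ hsup, pairing_add, h, h', add_zero]
  have e1 := hzero _ a1 h1
  have e2 := hzero _ (ab 0) (hb 0)
  have e3 := hzero _ (ab 1) (hb 1)
  have e4 := hzero _ ac hc
  have hall : ∀ i : Fin 4, (a + x) (Fin.castLE hn i) = 0 :=
    congrFun (eq_zero_of_four_checks (fun i => (a + x) (Fin.castLE hn i)) e1 e2 e3 e4)
  have hax0 : a + x = 0 := by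
    ext i
    by_cases h : (i : ℕ) < 4
    · exact hall ⟨i, h⟩
    · exact hsup i (by omega)
  rwa [← word_add_cancel_left a x, hax0, add_zero]

theorem pairing_fourOnes {n : ℕ} (hn : 4 ≤ n) (c : ℕ → ZMod 2) :
    pairing c (fourOnes n) = c 0 + c 1 + c 2 + c 3 := by
  rw [pairing_of_supported_four hn c (fourOnes n) fun i hi => if_neg (by omega)]
  simp [Fin.sum_univ_four, fourOnes]

theorem pairing_one_fourOnes {n : ℕ} (hn : 4 ≤ n) : pairing 1 (fourOnes n) = 0 := by
  rw [pairing_fourOnes hn]; decide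

theorem pairing_bitCoeff_fourOnes {n : ℕ} (hn : 4 ≤ n) (k : ℕ) :
    pairing (bitCoeff k) (fourOnes n) = 0 := by
  rw [pairing_fourOnes hn]
  match k with
  | 0 => decide
  | 1 => decide
  | k + 2 =>
    have h : ∀ i < 4, bitCoeff (k + 2) i = 0 := fun i hi => by
      have : 4 ≤ 2 ^ (k + 2) := Nat.pow_le_pow_right (n := 2) (i := 2) (by norm_num) (by omega)
      simp [bitCoeff, Nat.testBit_lt_two_pow (hi.trans_le this)]
    simp [h]

theorem pairing_cornerCoeff_fourOnes {n : ℕ} (hn : 4 ≤ n) :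
    pairing cornerCoeff (fourOnes n) = 1 := by
  rw [pairing_fourOnes hn]; decide

theorem even_hammingNorm_iff_of_length_two {n : ℕ} (hn : n = 2) (v : Word n) :
    Even (hammingNorm v) ↔ v = 0 ∨ v = 1 := by
  subst hn
  rw [even_hammingNorm_iff]
  simp only [pairing]
  revert v
  decide

theorem Vt_sub_one {m : ℕ} (hm : 2 ≤ m) : Vt m (m - 1) = {0, fourOnes (2 ^ m)} := by
  have hlen : 2 ^ (m - (m - 1)) = 2 := by rw [show m - (m - 1) = 1 by omega, pow_one]
  have h0 : embWord m (m - 1) 0 = 0 := by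
    ext i
    simp [embWord]
  have h1 : embWord m (m - 1) 1 = fourOnes (2 ^ m) := by
    ext i
    simp only [embWord, fourOnes, Pi.one_apply]
    split_ifs <;> first | rfl | omega
  ext x
  simp only [Vt, Set.mem_ofPred_eq, even_hammingNorm_iff_of_length_two hlen, or_and_right,
    exists_or, exists_eq_left, h0, h1, Set.mem_insert_iff, Set.mem_singleton_iff]

theorem bitCoeff_injOn {m : ℕ} {i j : Fin (2 ^ m)}
    (h : ∀ k, bitCoeff k i = bitCoeff k j) : i = j := by
  refine Fin.ext (Nat.eq_of_testBit_eq fun k => ?_)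
  have := h k
  simp only [bitCoeff] at this
  cases h1 : Nat.testBit i k <;> cases h2 : Nat.testBit j k <;> simp_all

theorem exists_bitCoeff_eq {m : ℕ} (x : Word (2 ^ m)) :
    ∃ i : Fin (2 ^ m), ∀ k, pairing (bitCoeff k) x = bitCoeff k i := by
  refine ⟨⟨Nat.ofBits fun k : Fin m => decide (pairing (bitCoeff k) x = 1),
    Nat.ofBits_lt_two_pow _⟩, fun k => ?_⟩
  by_cases hk : k < m
  · have h : ∀ a : ZMod 2, a = if decide (a = 1) then 1 else 0 := by decide
    simpa [bitCoeff, Nat.testBit_ofBits_lt _ _ hk] using h _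
  · have h : ∀ i : Fin (2 ^ m), bitCoeff k i = 0 := fun i => by
      have := i.2.trans_le (Nat.pow_le_pow_right (n := 2) (by norm_num) (not_lt.1 hk))
      simp [bitCoeff, Nat.testBit_lt_two_pow this]
    rw [h]
    exact Finset.sum_eq_zero fun i _ => by rw [h, zero_mul]

theorem pairing_one_of_mem_nbr {m : ℕ} (hm : 2 ≤ m) {y : Word (2 ^ m)}
    (hy : y ∈ nbr (At m (m - 2))) : pairing 1 y = 1 := by
  obtain ⟨i, hi⟩ := (mem_nbr_iff _ _).1 hy
  have := ((mem_At_sub_two_iff hm _).1 hi).1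
  rwa [pairing_add, pairing_single, CharTwo.add_eq_zero] at this

/-- Translation by `(1,1,1,1,0,…,0)` exchanges `Ω(A^{m-2})` with its complement among the words of
odd weight. -/
theorem fourOnes_add_mem_nbr_iff {m : ℕ} (hm : 2 ≤ m) {y : Word (2 ^ m)} (hy : pairing 1 y = 1) :
    fourOnes (2 ^ m) + y ∈ nbr (At m (m - 2)) ↔ y ∉ nbr (At m (m - 2)) := by
  have hn : 4 ≤ 2 ^ m := Nat.pow_le_pow_right (n := 2) (by norm_num) hm
  obtain ⟨i, hi⟩ := exists_bitCoeff_eq y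
  have hmem : ∀ z : Word (2 ^ m), pairing 1 z = 1 → (∀ k, pairing (bitCoeff k) z = bitCoeff k i) →
      (z ∈ nbr (At m (m - 2)) ↔ pairing cornerCoeff z = cornerCoeff i) := by
    intro z hz1 hzb
    simp only [mem_nbr_iff, mem_At_sub_two_iff hm, pairing_add, pairing_single,
      CharTwo.add_eq_zero, hzb]
    constructor
    · rintro ⟨j, _, hj, hjc⟩
      rwa [bitCoeff_injOn hj]
    · exact fun h => ⟨i, hz1, fun _ => rfl, h⟩
  rw [hmem y hy hi, hmem _ (by rw [pairing_add, pairing_one_fourOnes hn, hy, zero_add])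
    fun k => by rw [pairing_add, pairing_bitCoeff_fourOnes hn, hi, zero_add],
    pairing_add, pairing_cornerCoeff_fourOnes hn]
  generalize pairing cornerCoeff y = a
  generalize cornerCoeff i = b
  revert a b
  decide

theorem nbr_At_nonempty {m : ℕ} (hm : 2 ≤ m) : (nbr (At m (m - 2))).Nonempty := by
  refine ⟨Pi.single 0 1, (mem_nbr_iff _ _).2 ⟨0, ?_⟩⟩
  rw [word_add_self, mem_At_sub_two_iff hm]
  exact ⟨pairing_zero _, fun _ => pairing_zero _, pairing_zero _⟩

theorem mem_fourOnes_add_image_nbr_iff {m : ℕ} (hm : 2 ≤ m) (y : Word (2 ^ m)) :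
    y ∈ (fun y => fourOnes (2 ^ m) + y) '' nbr (At m (m - 2)) ↔
      pairing 1 y = 1 ∧ y ∉ nbr (At m (m - 2)) := by
  have hn : 4 ≤ 2 ^ m := Nat.pow_le_pow_right (n := 2) (by norm_num) hm
  constructor
  · rintro ⟨z, hz, rfl⟩
    have hz1 := pairing_one_of_mem_nbr hm hz
    exact ⟨by simp only [pairing_add, pairing_one_fourOnes hn, hz1, zero_add],
      fun h => (fourOnes_add_mem_nbr_iff hm hz1).1 h hz⟩
  · rintro ⟨h1, h⟩
    exact ⟨_, (fourOnes_add_mem_nbr_iff hm h1).2 h, word_add_cancel_left _ _⟩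

theorem IsIsometry.pairing_one {n : ℕ} {g : Word n → Word n} (hg : IsIsometry g)
    {x₀ : Word n} (h : pairing 1 (g x₀) = pairing 1 x₀) (x : Word n) :
    pairing 1 (g x) = pairing 1 x := by
  have := congrArg (Nat.cast : ℕ → ZMod 2) (hg.2 x x₀)
  rw [natCast_hammingDist, natCast_hammingDist, h] at this
  exact add_right_cancel this

/-- An isometry preserving `Ω(A^{m-2})` preserves its translate by `(1,1,1,1,0,…,0)`. -/
theorem IsIsometry.image_fourOnes_add_nbr {m : ℕ} (hm : 2 ≤ m) {g : Word (2 ^ m) → Word (2 ^ m)}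
    (hg : IsIsometry g) (hN : g '' nbr (At m (m - 2)) = nbr (At m (m - 2))) :
    g '' ((fun y => fourOnes (2 ^ m) + y) '' nbr (At m (m - 2))) =
      (fun y => fourOnes (2 ^ m) + y) '' nbr (At m (m - 2)) := by
  obtain ⟨x₀, hx₀⟩ := nbr_At_nonempty hm
  have hpar := hg.pairing_one ((pairing_one_of_mem_nbr hm (hN ▸ Set.mem_image_of_mem g hx₀)).trans
    (pairing_one_of_mem_nbr hm hx₀).symm)
  have hmem : ∀ x, g x ∈ nbr (At m (m - 2)) ↔ x ∈ nbr (At m (m - 2)) := fun x => by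
    conv_lhs => rw [← hN]
    exact hg.1.1.mem_set_image
  ext y
  obtain ⟨x, rfl⟩ := hg.1.2 y
  rw [hg.1.1.mem_set_image, mem_fourOnes_add_image_nbr_iff hm, mem_fourOnes_add_image_nbr_iff hm,
    hpar, hmem]

theorem IsIsometry.comp_add {n : ℕ} {g : Word n → Word n} (hg : IsIsometry g) (a : Word n) :
    IsIsometry (g ∘ fun x => a + x) := by
  refine ⟨hg.1.comp (Equiv.addLeft a).bijective, fun x y => ?_⟩
  simp only [Function.comp_apply, hg.2]
  simp only [hammingDist_eq_hammingNorm, neg_add_rev, neg_add_cancel_left, add_assoc]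

theorem translates_nbr_eq {m : ℕ} (hm : 2 ≤ m) :
    {S : Set (Word (2 ^ m)) | ∃ r ∈ Vt m (m - 1), S = (fun y => r + y) '' nbr (At m (m - 2))} =
      {nbr (At m (m - 2)), (fun y => fourOnes (2 ^ m) + y) '' nbr (At m (m - 2))} := by
  ext S
  simp [Vt_sub_one hm]

/-- with τ the translation by (1,1,1,1,0,…,0), an isometry of F^n preserves
the collection {r + Ω(A^{m-2})}_{r ∈ V^{m-1}} iff it lies in Aut(Ω(A^{m-2})) or is the
composition of an element of Aut(Ω(A^{m-2})) with τ. -/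
theorem stmt_14 (m : ℕ) (hm : 4 ≤ m)
    (g : Word (2 ^ m) → Word (2 ^ m)) (hg : IsIsometry g) :
    (∀ S ∈ {S : Set (Word (2 ^ m)) |
        ∃ r ∈ Vt m (m - 1), S = (fun y => r + y) '' nbr (At m (m - 2))},
      g '' S ∈ {S : Set (Word (2 ^ m)) |
        ∃ r ∈ Vt m (m - 1), S = (fun y => r + y) '' nbr (At m (m - 2))}) ↔
    (g '' nbr (At m (m - 2)) = nbr (At m (m - 2)) ∨
      ∃ h : Word (2 ^ m) → Word (2 ^ m), IsIsometry h ∧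
        h '' nbr (At m (m - 2)) = nbr (At m (m - 2)) ∧
        g = h ∘ (fun x => (fun i : Fin (2 ^ m) => if (i : ℕ) < 4 then (1 : ZMod 2) else 0) + x)) := by
  have hm2 : 2 ≤ m := by omega
  have himage : ∀ S : Set (Word (2 ^ m)), (fun y => fourOnes (2 ^ m) + y) ''
      ((fun y => fourOnes (2 ^ m) + y) '' S) = S := fun S => by
    simp only [Set.image_image, word_add_cancel_left, Set.image_id']
  rw [translates_nbr_eq hm2]
  change _ ↔ _ ∨ ∃ h, _ ∧ _ ∧ g = h ∘ fun x => fourOnes (2 ^ m) + x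
  simp only [Set.mem_insert_iff, Set.mem_singleton_iff, forall_eq_or_imp, forall_eq]
  constructor
  · rintro ⟨h1 | h1, h2⟩
    · exact Or.inl h1
    · rcases h2 with h2 | h2
      · refine Or.inr ⟨_, hg.comp_add (fourOnes (2 ^ m)), by rwa [Set.image_comp], ?_⟩
        ext1 x
        simp only [Function.comp_apply, word_add_cancel_left]
      · refine Or.inl ?_
        rw [h1]
        exact (Set.image_injective.2 hg.1.1 (h1.trans h2.symm)).symm
  · rintro (h | ⟨h, hh, hN, rfl⟩)
    · exact ⟨Or.inl h, Or.inr (hg.image_fourOnes_add_nbr hm2 h)⟩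
    · exact ⟨Or.inr (by rw [Set.image_comp, hh.image_fourOnes_add_nbr hm2 hN]),
        Or.inl (by rw [Set.image_comp, himage, hN])⟩
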